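/- Let C ≥ 1, b > 0 and 0 ≤ ε ≤ 1. Let g₁, g₂ : (0, b] → ℝ be differentiable functions with 1/C ≤ g_i(t) ≤ C and |g_i'(t)| ≤ C for all t ∈ (0, b] and i = 1, 2, and suppose g₁(t) ≤ e^ε·g₂(t) and g₂(t) ≤ e^ε·g₁(t) for all t. Let h : (0, b] → (0, b] satisfy ∫₀^c t^{−1/2} g₁(t) dt = ∫₀^{h(c)} t^{−1/2} g₂(t) dt for all c ∈ (0, b]. Then there is a constant K, depending only on C and b, such that for all c ∈ (0, b]: | log( g₁(c)·√(h(c)) / ( g₂(h(c))·√c ) ) | ≤ K·ε. -/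

import Mathlib

open MeasureTheory

lemma aux_int (b m M : ℝ) (g : ℝ → ℝ) (hg : ContinuousOn g (Set.Ioc (0:ℝ) b))
    (hb : ∀ t ∈ Set.Ioc (0:ℝ) b, m ≤ g t ∧ g t ≤ M) (x y : ℝ) (hx : 0 ≤ x) (hxy : x ≤ y)
    (hy : y ≤ b) :
    IntervalIntegrable (fun t : ℝ => t ^ (-(1:ℝ)/2) * g t) volume x y := by
  have hr : IntervalIntegrable (fun t : ℝ => t ^ (-(1:ℝ)/2)) volume x y :=
    intervalIntegral.intervalIntegrable_rpow' (by norm_num)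
  rw [intervalIntegrable_iff_integrableOn_Ioc_of_le hxy] at hr ⊢
  have hsub : Set.Ioc x y ⊆ Set.Ioc 0 b := Set.Ioc_subset_Ioc hx hy
  refine Integrable.mul_bdd (c := max |m| |M|) hr
    ((hg.mono hsub).aestronglyMeasurable measurableSet_Ioc) ?_
  filter_upwards [ae_restrict_mem measurableSet_Ioc] with t ht
  have := hb t (hsub ht)
  rw [Real.norm_eq_abs]
  exact abs_le_max_abs_abs this.1 this.2

lemma aux_val (x y m : ℝ) (hx : 0 ≤ x) (hxy : x ≤ y) :
    ∫ t in x..y, t ^ (-(1:ℝ)/2) * m = 2 * m * (√y - √x) := by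
  rw [intervalIntegral.integral_mul_const, integral_rpow (Or.inl (by norm_num))]
  rw [Real.sqrt_eq_rpow, Real.sqrt_eq_rpow]
  norm_num
  ring

lemma aux_bd (b m M : ℝ) (g : ℝ → ℝ) (hg : ContinuousOn g (Set.Ioc (0:ℝ) b))
    (hb : ∀ t ∈ Set.Ioc (0:ℝ) b, m ≤ g t ∧ g t ≤ M) (x y : ℝ) (hx : 0 ≤ x) (hxy : x ≤ y)
    (hy : y ≤ b) :
    2 * m * (√y - √x) ≤ ∫ t in x..y, t ^ (-(1:ℝ)/2) * g t ∧
    ∫ t in x..y, t ^ (-(1:ℝ)/2) * g t ≤ 2 * M * (√y - √x) := by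
  have hi := aux_int b m M g hg hb x y hx hxy hy
  have hr : IntervalIntegrable (fun t : ℝ => t ^ (-(1:ℝ)/2)) volume x y :=
    intervalIntegral.intervalIntegrable_rpow' (by norm_num)
  rw [← aux_val x y m hx hxy, ← aux_val x y M hx hxy]
  constructor
  · refine intervalIntegral.integral_mono_on_of_le_Ioo hxy (hr.mul_const _) hi ?_
    intro t ht
    have h0 : 0 < t := lt_of_le_of_lt hx ht.1
    exact mul_le_mul_of_nonneg_left (hb t ⟨h0, ht.2.le.trans hy⟩).1 (Real.rpow_nonneg h0.le _)
  · refine intervalIntegral.integral_mono_on_of_le_Ioo hxy hi (hr.mul_const _) ?_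
    intro t ht
    have h0 : 0 < t := lt_of_le_of_lt hx ht.1
    exact mul_le_mul_of_nonneg_left (hb t ⟨h0, ht.2.le.trans hy⟩).2 (Real.rpow_nonneg h0.le _)

lemma aux_log (p q D : ℝ) (hp : 0 < p) (hq : 0 < q) (h1 : |p - q| ≤ D * p)
    (h2 : |p - q| ≤ D * q) : |Real.log p - Real.log q| ≤ D := by
  have key : ∀ p q : ℝ, 0 < p → 0 < q → |p - q| ≤ D * q → Real.log p - Real.log q ≤ D := by
    intro p q hp hq h
    rw [← Real.log_div hp.ne' hq.ne']
    have := Real.log_le_sub_one_of_pos (div_pos hp hq)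
    have h3 : p / q ≤ D + 1 := by
      rw [div_le_iff₀ hq]
      linarith [le_abs_self (p - q)]
    linarith
  rw [abs_le]
  have := key p q hp hq h2
  have := key q p hq hp (by rwa [abs_sub_comm])
  constructor <;> linarith

/-- main estimate of the quasisymmetry Lemma, Section 6: if `g₁, g₂` are
differentiable on `(0,b]` with values in `[1/C, C]`, derivatives bounded by `C`, and agree
within a factor `e^ε` (`0 ≤ ε ≤ 1`), and `h : (0,b] → (0,b]` is defined by matching the flat
lengths `∫₀^c t^{-1/2} g₁ = ∫₀^{h(c)} t^{-1/2} g₂`, then the derivative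
`h'(c) = g₁(c)√(h(c))/(g₂(h(c))√c)` satisfies `|log h'(c)| ≤ Kε` with `K = K(C,b)`. -/
theorem stmt14 (C b : ℝ) (hC : 1 ≤ C) (hb : 0 < b) :
    ∃ K : ℝ, ∀ ε : ℝ, 0 ≤ ε → ε ≤ 1 →
      ∀ g₁ g₂ h : ℝ → ℝ,
        (∀ t ∈ Set.Ioc (0:ℝ) b, ∃ d : ℝ,
          HasDerivWithinAt g₁ d (Set.Ioc (0:ℝ) b) t ∧ |d| ≤ C) →
        (∀ t ∈ Set.Ioc (0:ℝ) b, ∃ d : ℝ,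
          HasDerivWithinAt g₂ d (Set.Ioc (0:ℝ) b) t ∧ |d| ≤ C) →
        (∀ t ∈ Set.Ioc (0:ℝ) b, 1 / C ≤ g₁ t ∧ g₁ t ≤ C) →
        (∀ t ∈ Set.Ioc (0:ℝ) b, 1 / C ≤ g₂ t ∧ g₂ t ≤ C) →
        (∀ t ∈ Set.Ioc (0:ℝ) b, g₁ t ≤ Real.exp ε * g₂ t ∧ g₂ t ≤ Real.exp ε * g₁ t) →
        (∀ c ∈ Set.Ioc (0:ℝ) b, h c ∈ Set.Ioc (0:ℝ) b) →
        (∀ c ∈ Set.Ioc (0:ℝ) b,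
          ∫ t in (0:ℝ)..c, t ^ (-(1:ℝ)/2) * g₁ t =
            ∫ t in (0:ℝ)..(h c), t ^ (-(1:ℝ)/2) * g₂ t) →
        ∀ c ∈ Set.Ioc (0:ℝ) b,
          |Real.log (g₁ c * Real.sqrt (h c) / (g₂ (h c) * Real.sqrt c))| ≤ K * ε := by
  refine ⟨1 + 4 * C ^ 4 * b + 2 * C ^ 4, ?_⟩
  intro ε hε0 hε1 g₁ g₂ h hd1 hd2 hb1 hb2 hcmp hh hint c hc
  have hC0 : 0 < C := by linarith
  have c1 : ContinuousOn g₁ (Set.Ioc 0 b) := fun t ht => by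
    obtain ⟨d, hd, -⟩ := hd1 t ht
    exact hd.continuousWithinAt
  have c2 : ContinuousOn g₂ (Set.Ioc 0 b) := fun t ht => by
    obtain ⟨d, hd, -⟩ := hd2 t ht
    exact hd.continuousWithinAt
  have hu := hh c hc
  have hI := hint c hc
  set u := h c with hudef
  have hexp : Real.exp ε - 1 ≤ 2 * ε := by
    have := Real.abs_exp_sub_one_le (x := ε) (by rwa [abs_of_nonneg hε0])
    rw [abs_of_nonneg hε0] at this
    exact (le_abs_self _).trans this
  have hdiff : ∀ t ∈ Set.Ioc (0:ℝ) b, -(2 * ε * C) ≤ g₁ t - g₂ t ∧ g₁ t - g₂ t ≤ 2 * ε * C := by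
    intro t ht
    have h1 := hb1 t ht
    have h2 := hb2 t ht
    have h3 := hcmp t ht
    have hp : 0 < 1 / C := by positivity
    have e1 : (Real.exp ε - 1) * g₁ t ≤ 2 * ε * C :=
      mul_le_mul hexp h1.2 (by linarith) (by linarith)
    have e2 : (Real.exp ε - 1) * g₂ t ≤ 2 * ε * C :=
      mul_le_mul hexp h2.2 (by linarith) (by linarith)
    constructor <;> linarith
  have hsc : 0 < √c := Real.sqrt_pos.2 hc.1
  have hsu : 0 < √u := Real.sqrt_pos.2 hu.1
  have A := aux_bd b _ _ (fun t => g₁ t - g₂ t) (c1.sub c2) hdiff 0 c le_rfl hc.1.le hc.2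
  have i1 := aux_int b _ _ g₁ c1 hb1 0 c le_rfl hc.1.le hc.2
  have i2 := aux_int b _ _ g₂ c2 hb2 0 c le_rfl hc.1.le hc.2
  have i3 := aux_int b _ _ g₂ c2 hb2 0 u le_rfl hu.1.le hu.2
  simp only [mul_sub] at A
  rw [intervalIntegral.integral_sub i1 i2, hI] at A
  have hs : |√c - √u| ≤ 2 * C ^ 2 * ε * √c := by
    have key : ∀ s : ℝ, 2 * (1 / C) * s ≤ 2 * ε * C * (2 * √c) → s ≤ 2 * C ^ 2 * ε * √c := by
      intro s hs
      have := mul_le_mul_of_nonneg_left hs hC0.le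
      have e : C * (2 * (1 / C) * s) = 2 * s := by field_simp
      rw [e] at this
      nlinarith
    simp only [Real.sqrt_zero, mul_zero, sub_zero] at A
    rcases le_total c u with hcu | hcu
    · have B := (aux_bd b _ _ g₂ c2 hb2 c u hc.1.le hcu hu.2).1
      have := intervalIntegral.integral_interval_sub_left i3 i2
      rw [abs_sub_comm, abs_of_nonneg (by linarith [Real.sqrt_le_sqrt hcu])]
      apply key
      linarith
    · have B := (aux_bd b _ _ g₂ c2 hb2 u c hu.1.le hcu hc.2).1
      have := intervalIntegral.integral_interval_sub_left i2 i3
      rw [abs_of_nonneg (by linarith [Real.sqrt_le_sqrt hcu])]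
      apply key
      linarith
  have hcu : √c ≤ C ^ 2 * √u := by
    have a1 := (aux_bd b _ _ g₁ c1 hb1 0 c le_rfl hc.1.le hc.2).1
    have a2 := (aux_bd b _ _ g₂ c2 hb2 0 u le_rfl hu.1.le hu.2).2
    simp only [Real.sqrt_zero, sub_zero] at a1 a2
    have a3 := mul_le_mul_of_nonneg_left (a1.trans (hI.le.trans a2)) hC0.le
    have e : C * (2 * (1 / C) * √c) = 2 * √c := by field_simp
    rw [e] at a3
    nlinarith
  have hC2 : 1 ≤ C ^ 2 := one_le_pow₀ hC
  have hC4 : C ^ 2 ≤ C ^ 4 := pow_le_pow_right₀ hC (by norm_num)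
  have L1 : |Real.log √c - Real.log √u| ≤ 2 * C ^ 4 * ε := by
    apply aux_log _ _ _ hsc hsu
    · refine hs.trans ?_
      gcongr
    · refine hs.trans ?_
      calc 2 * C ^ 2 * ε * √c ≤ 2 * C ^ 2 * ε * (C ^ 2 * √u) := by gcongr
        _ = _ := by ring
  have p1 : 0 < g₁ c := lt_of_lt_of_le (by positivity) (hb1 c hc).1
  have p2 : 0 < g₂ c := lt_of_lt_of_le (by positivity) (hb2 c hc).1
  have p3 : 0 < g₂ u := lt_of_lt_of_le (by positivity) (hb2 u hu).1
  have L2 : |Real.log (g₁ c) - Real.log (g₂ c)| ≤ ε := by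
    have a1 := Real.log_le_log p1 (hcmp c hc).1
    have a2 := Real.log_le_log p2 (hcmp c hc).2
    rw [Real.log_mul (Real.exp_pos _).ne' p2.ne', Real.log_exp] at a1
    rw [Real.log_mul (Real.exp_pos _).ne' p1.ne', Real.log_exp] at a2
    rw [abs_le]
    constructor <;> linarith
  have hcub : |c - u| ≤ 4 * C ^ 2 * ε * b := by
    have e : c - u = (√c - √u) * (√c + √u) := by
      have := Real.mul_self_sqrt hc.1.le
      have := Real.mul_self_sqrt hu.1.le
      linarith
    have b1 := Real.sqrt_le_sqrt hc.2
    have b2 := Real.sqrt_le_sqrt hu.2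
    rw [e, abs_mul, abs_of_pos (add_pos hsc hsu)]
    calc |√c - √u| * (√c + √u) ≤ (2 * C ^ 2 * ε * √b) * (√b + √b) := by
          gcongr
          refine hs.trans ?_
          gcongr
      _ = 4 * C ^ 2 * ε * (√b * √b) := by ring
      _ = _ := by rw [Real.mul_self_sqrt hb.le]
  have hlip : |g₂ c - g₂ u| ≤ C * |c - u| := by
    choose! d hd hdC using hd2
    have := (convex_Ioc (0:ℝ) b).norm_image_sub_le_of_norm_hasDerivWithin_le
      (f := g₂) (f' := d) (C := C) hd hdC hu hc
    simpa [Real.norm_eq_abs] using this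
  have L3 : |Real.log (g₂ c) - Real.log (g₂ u)| ≤ 4 * C ^ 4 * b * ε := by
    have hmain : |g₂ c - g₂ u| ≤ 4 * C ^ 4 * b * ε * (1 / C) := by
      have e : 4 * C ^ 4 * b * ε * (1 / C) = C * (4 * C ^ 2 * ε * b) := by field_simp
      rw [e]
      exact hlip.trans (by gcongr)
    have hn : 0 ≤ 4 * C ^ 4 * b * ε := by positivity
    exact aux_log _ _ _ p2 p3 (hmain.trans (mul_le_mul_of_nonneg_left (hb2 c hc).1 hn))
      (hmain.trans (mul_le_mul_of_nonneg_left (hb2 u hu).1 hn))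
  rw [Real.log_div (by positivity) (by positivity), Real.log_mul p1.ne' hsu.ne',
    Real.log_mul p3.ne' hsc.ne']
  rw [abs_le] at *
  constructor <;> linarith [L1.1, L1.2, L2.1, L2.2, L3.1, L3.2]
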